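/- Let $k$ be a field of characteristic $p > 0$ and let $G$ be a smooth connected affine algebraic group over $k$. If the Frobenius kernel $G_1$ of $G$ has trivial restricted unipotent radical (i.e. $G_1$ contains no nontrivial unipotent normal subgroup scheme), then $G$ is pseudo-reductive, i.e. the unipotent radical $\mathscr{R}_u(G)$ (the largest smooth connected unipotent normal $k$-subgroup) is trivial. -/

import Mathlib

/- # Preliminaries: affine group schemes via commutative Hopf algebras

An affine algebraic group scheme `G` over a field `k` is encoded by its coordinate
Hopf algebra `A = O(G)` (a commutative Hopf `k`-algebra of finite type).  The group
of `R`-points is `G(R) = Hom_{k-alg}(A, R)`, with multiplication given by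
convolution through the comultiplication.  Closed subgroup schemes are encoded by
surjective maps of Hopf algebras `A →ₐc[k] B`. -/

open TensorProduct

noncomputable section

/-- The product of two `R`-points of the affine group scheme `Spec A`,
given by convolution through the comultiplication of `A`. -/
def ptMul {k A R : Type} [CommRing k] [CommRing A] [Bialgebra k A]
    [CommRing R] [Algebra k R] (f g : A →ₐ[k] R) : A →ₐ[k] R :=
  (Algebra.TensorProduct.productMap f g).comp (Bialgebra.comulAlgHom k A)

/-- The identity `R`-point of the affine group scheme `Spec A`. -/
def ptOne {k A : Type} [CommRing k] [CommRing A] [Bialgebra k A]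
    (R : Type) [CommRing R] [Algebra k R] : A →ₐ[k] R :=
  (Algebra.ofId k R).comp (Bialgebra.counitAlgHom k A)

/-- A closed subgroup scheme of the affine group scheme `Spec A`, encoded by a
surjection of commutative Hopf algebras `π : A → B`; the subgroup is `Spec B`. -/
structure ClosedSubgrp (k A : Type) [CommRing k] [CommRing A] [HopfAlgebra k A] where
  B : Type
  [commRing : CommRing B]
  [hopf : HopfAlgebra k B]
  π : A →ₐc[k] B
  surj : Function.Surjective π

attribute [instance] ClosedSubgrp.commRing ClosedSubgrp.hopf

namespace ClosedSubgrp

variable {k A : Type} [CommRing k] [CommRing A] [HopfAlgebra k A]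

/-- An `R`-point of `Spec A` lies in the closed subgroup iff it factors through `π`. -/
def mem (H : ClosedSubgrp k A) {R : Type} [CommRing R] [Algebra k R]
    (f : A →ₐ[k] R) : Prop :=
  ∃ g : H.B →ₐ[k] R, f = g.comp (H.π : A →ₐ[k] H.B)

/-- Containment of closed subgroup schemes, tested on points. -/
def le (H H' : ClosedSubgrp k A) : Prop :=
  ∀ (R : Type) [CommRing R] [Algebra k R], ∀ f : A →ₐ[k] R, H.mem f → H'.mem f

/-- Normality of a closed subgroup scheme, tested on points:
for every `g ∈ G(R)` and `f ∈ H(R)` the conjugate `g f g⁻¹` lies in `H(R)`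
(phrased multiplicatively: `g * f = f' * g` for some `f' ∈ H(R)`). -/
def Normal (H : ClosedSubgrp k A) : Prop :=
  ∀ (R : Type) [CommRing R] [Algebra k R], ∀ f g : A →ₐ[k] R,
    H.mem f → ∃ f' : A →ₐ[k] R, H.mem f' ∧ ptMul g f = ptMul f' g

/-- The closed subgroup scheme is trivial: all its points are the identity. -/
def Trivial (H : ClosedSubgrp k A) : Prop :=
  ∀ (R : Type) [CommRing R] [Algebra k R], ∀ f : A →ₐ[k] R, H.mem f → f = ptOne R

end ClosedSubgrp

/-- A (right) comodule structure on `V` over the coalgebra underlying `B`;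
equivalently, a linear representation of the affine group scheme `Spec B`. -/
structure Coaction (k B V : Type) [CommRing k] [CommRing B] [Bialgebra k B]
    [AddCommGroup V] [Module k V] where
  ρ : V →ₗ[k] V ⊗[k] B
  counit_law : ∀ v : V,
    TensorProduct.rid k V (LinearMap.lTensor V (Coalgebra.counit (R := k) (A := B)) (ρ v)) = v
  coassoc : ∀ v : V, LinearMap.rTensor B ρ (ρ v)
      = (TensorProduct.assoc k V B B).symm
          (LinearMap.lTensor V (Coalgebra.comul (R := k) (A := B)) (ρ v))

/-- The affine group scheme `Spec B` is unipotent: every nonzero finite-dimensional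
linear representation has a nonzero fixed vector. -/
def IsUnipotentHopf (k B : Type) [CommRing k] [CommRing B] [HopfAlgebra k B] : Prop :=
  ∀ (V : Type) [AddCommGroup V] [Module k V] [Module.Finite k V],
    ∀ c : Coaction k B V, Nontrivial V → ∃ v : V, v ≠ 0 ∧ c.ρ v = v ⊗ₜ[k] (1 : B)

/-- `U` is the restricted unipotent radical of `Spec A`: a unipotent normal closed
subgroup scheme containing every unipotent normal closed subgroup scheme. -/
def IsRadU {k A : Type} [CommRing k] [CommRing A] [HopfAlgebra k A]
    (U : ClosedSubgrp k A) : Prop :=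
  U.Normal ∧ IsUnipotentHopf k U.B ∧
    ∀ H : ClosedSubgrp k A, H.Normal → IsUnipotentHopf k H.B → H.le U

/-- The affine group scheme `Spec A` is commutative. -/
def IsCommutativeHopf (k A : Type) [CommRing k] [CommRing A] [Bialgebra k A] : Prop :=
  ∀ (R : Type) [CommRing R] [Algebra k R], ∀ f g : A →ₐ[k] R, ptMul f g = ptMul g f


/-- An `R`-point `f : A →ₐ[k] R` of the affine group scheme `Spec A` lies in the
(first) Frobenius kernel `G₁ = ker (F : G → G^(p))` iff it kills the ideal generated by
`p`-th powers of elements of the augmentation ideal, i.e. `f a ^ p = 0` whenever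
`ε a = 0`. -/
def InFrobKer (p : ℕ) {k A : Type} [CommRing k] [CommRing A] [Bialgebra k A]
    {R : Type} [CommRing R] [Algebra k R] (f : A →ₐ[k] R) : Prop :=
  ∀ a : A, Coalgebra.counit (R := k) a = 0 → f a ^ p = 0

section Contraction

variable {k B V W : Type} [Field k] [AddCommGroup B] [Module k B] [AddCommGroup V] [Module k V]
  [AddCommGroup W] [Module k W]

/-- Contraction of the second tensor factor against a linear form. -/
def contract (V : Type) [AddCommGroup V] [Module k V] (φ : B →ₗ[k] k) : V ⊗[k] B →ₗ[k] V :=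
  (TensorProduct.rid k V).toLinearMap ∘ₗ LinearMap.lTensor V φ

@[simp]
lemma contract_tmul (φ : B →ₗ[k] k) (v : V) (b : B) : contract V φ (v ⊗ₜ[k] b) = φ b • v := by
  simp [contract]

lemma contract_rTensor (φ : B →ₗ[k] k) (f : V →ₗ[k] W) (t : V ⊗[k] B) :
    contract W φ (LinearMap.rTensor B f t) = f (contract V φ t) := by
  induction t with
  | zero => simp
  | tmul v b => simp
  | add x y hx hy => simp only [map_add, hx, hy]

lemma eq_zero_of_contract_eq_zero {t : V ⊗[k] B} (h : ∀ φ : B →ₗ[k] k, contract V φ t = 0) :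
    t = 0 := by
  classical
  let b := Module.Basis.ofVectorSpace k B
  apply (TensorProduct.equivFinsuppOfBasisRight (M := V) b).injective
  ext i
  rw [TensorProduct.equivFinsuppOfBasisRight_apply, map_zero, Finsupp.zero_apply]
  exact h (b.coord i)

lemma mem_range_rTensor_of_contract_mem (E : Submodule k V) {t : V ⊗[k] B}
    (h : ∀ φ : B →ₗ[k] k, contract V φ t ∈ E) :
    t ∈ LinearMap.range (LinearMap.rTensor B E.subtype) := by
  refine (rTensor_exact B (LinearMap.exact_subtype_mkQ E) E.mkQ_surjective t).1 ?_
  refine eq_zero_of_contract_eq_zero fun φ => ?_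
  rw [contract_rTensor]
  simpa using h φ

lemma exists_fg_forall_contract_mem (t : V ⊗[k] B) :
    ∃ F : Submodule k V, F.FG ∧ ∀ φ : B →ₗ[k] k, contract V φ t ∈ F := by
  induction t with
  | zero => exact ⟨⊥, Submodule.fg_bot, by simp⟩
  | tmul v b =>
    exact ⟨Submodule.span k {v}, Submodule.fg_span_singleton v, fun φ => by
      rw [contract_tmul]
      exact Submodule.smul_mem _ _ (Submodule.mem_span_singleton_self v)⟩
  | add x y hx hy =>
    obtain ⟨F, hF, h⟩ := hx
    obtain ⟨F', hF', h'⟩ := hy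
    refine ⟨F ⊔ F', hF.sup hF', fun φ => ?_⟩
    rw [map_add]
    exact Submodule.add_mem_sup (h φ) (h' φ)

end Contraction

namespace Coaction

section Action

variable {k B V W : Type} [Field k] [CommRing B] [HopfAlgebra k B] [AddCommGroup V] [Module k V]
  [AddCommGroup W] [Module k W]

/-- The action of the linear dual of the coalgebra on a comodule. -/
def act (c : Coaction k B V) (φ : B →ₗ[k] k) : V →ₗ[k] V :=
  contract V φ ∘ₗ c.ρ

lemma act_apply (c : Coaction k B V) (φ : B →ₗ[k] k) (v : V) :
    c.act φ v = contract V φ (c.ρ v) := rfl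

lemma act_counit (c : Coaction k B V) (v : V) : c.act Coalgebra.counit v = v :=
  c.counit_law v

lemma act_act (c : Coaction k B V) (φ ψ : B →ₗ[k] k) (v : V) :
    c.act ψ (c.act φ v) = c.act (φ ∘ₗ contract B ψ ∘ₗ
      (TensorProduct.comm k B B).toLinearMap ∘ₗ Coalgebra.comul) v := by
  have key : ∀ t : V ⊗[k] (B ⊗[k] B), contract V ψ (contract (V ⊗[k] B) φ
      ((TensorProduct.assoc k V B B).symm t)) =
      contract V (φ ∘ₗ contract B ψ ∘ₗ (TensorProduct.comm k B B).toLinearMap) t := by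
    intro t
    induction t with
    | zero => simp
    | add x y hx hy => simp only [map_add, hx, hy]
    | tmul v t =>
      induction t with
      | zero => simp
      | add x y hx hy => simp only [map_add, TensorProduct.tmul_add, hx, hy]
      | tmul x y => simp [smul_smul, mul_comm]
  have h := congrArg (fun t => contract V ψ (contract (V ⊗[k] B) φ t)) (c.coassoc v)
  simp only [key, contract_rTensor] at h
  rw [act_apply, act_apply, h, act_apply]
  simp only [contract, LinearMap.comp_apply, LinearMap.lTensor_comp_apply]

lemma ρ_eq_tmul_one_of_act_eq_zero (c : Coaction k B V) {v : V}
    (h : ∀ φ : B →ₗ[k] k, φ 1 = 0 → c.act φ v = 0) : c.ρ v = v ⊗ₜ[k] (1 : B) := by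
  rw [← sub_eq_zero]
  refine eq_zero_of_contract_eq_zero fun φ => ?_
  have h1 := h (φ - φ 1 • Coalgebra.counit) (by simp)
  have h2 : c.act (φ - φ 1 • Coalgebra.counit) v
      = c.act φ v - φ 1 • c.act Coalgebra.counit v := by
    simp only [act_apply, contract, LinearMap.lTensor_sub, LinearMap.lTensor_smul,
      LinearMap.comp_apply, LinearMap.sub_apply, LinearMap.smul_apply, map_sub, map_smul]
  rw [h2, act_counit] at h1
  rw [map_sub, contract_tmul]
  exact h1

/-- `v` is killed by every product of `n` linear forms vanishing at `1`. -/
def IsNil (c : Coaction k B V) : ℕ → V → Prop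
  | 0, v => v = 0
  | n + 1, v => ∀ φ : B →ₗ[k] k, φ 1 = 0 → c.IsNil n (c.act φ v)

lemma isNil_zero (c : Coaction k B V) (n : ℕ) : c.IsNil n 0 := by
  induction n with
  | zero => rfl
  | succ n ih => intro φ _; simpa using ih

lemma IsNil.succ {c : Coaction k B V} {n : ℕ} {v : V} (h : c.IsNil n v) : c.IsNil (n + 1) v := by
  induction n generalizing v with
  | zero =>
    obtain rfl : v = 0 := h
    exact c.isNil_zero 1
  | succ n ih => exact fun φ hφ => ih (h φ hφ)

lemma IsNil.mono {c : Coaction k B V} {m n : ℕ} (hmn : m ≤ n) {v : V} (h : c.IsNil m v) :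
    c.IsNil n v := by
  induction hmn with
  | refl => exact h
  | step _ ih => exact ih.succ

lemma IsNil.exists_fixed {c : Coaction k B V} {n : ℕ} {v : V} (h : c.IsNil n v) (hv : v ≠ 0) :
    ∃ w : V, w ≠ 0 ∧ c.ρ w = w ⊗ₜ[k] (1 : B) := by
  induction n generalizing v with
  | zero => exact absurd h hv
  | succ n ih =>
    by_cases h0 : ∀ φ : B →ₗ[k] k, φ 1 = 0 → c.act φ v = 0
    · exact ⟨v, hv, c.ρ_eq_tmul_one_of_act_eq_zero h0⟩
    · push Not at h0
      obtain ⟨φ, hφ, hne⟩ := h0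
      exact ih (h φ hφ) hne

/-- A linear map is a morphism of comodules. -/
def IsHom (c : Coaction k B V) (d : Coaction k B W) (f : V →ₗ[k] W) : Prop :=
  ∀ v, d.ρ (f v) = LinearMap.rTensor B f (c.ρ v)

lemma IsHom.act_map {c : Coaction k B V} {d : Coaction k B W} {f : V →ₗ[k] W}
    (hf : c.IsHom d f) (φ : B →ₗ[k] k) (v : V) : d.act φ (f v) = f (c.act φ v) := by
  rw [act_apply, hf, contract_rTensor, act_apply]

lemma IsNil.map {c : Coaction k B V} {d : Coaction k B W} {f : V →ₗ[k] W} (hf : c.IsHom d f)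
    {n : ℕ} {v : V} (h : c.IsNil n v) : d.IsNil n (f v) := by
  induction n generalizing v with
  | zero =>
    obtain rfl : v = 0 := h
    exact map_zero f
  | succ n ih =>
    intro φ hφ
    rw [hf.act_map]
    exact ih (h φ hφ)

lemma isNil_of_forall_map {ι : Type} {c : Coaction k B V} {d : Coaction k B W}
    {f : ι → V →ₗ[k] W} (hf : ∀ i, c.IsHom d (f i)) (hinj : ∀ v, (∀ i, f i v = 0) → v = 0)
    {n : ℕ} {v : V} (h : ∀ i, d.IsNil n (f i v)) : c.IsNil n v := by
  induction n generalizing v with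
  | zero => exact hinj v h
  | succ n ih =>
    intro φ hφ
    refine ih fun i => ?_
    rw [← (hf i).act_map]
    exact h i φ hφ

end Action

section Constructions

variable {k B V : Type} [Field k] [CommRing B] [HopfAlgebra k B] [AddCommGroup V] [Module k V]

/-- The regular comodule. -/
def regular (k B : Type) [Field k] [CommRing B] [HopfAlgebra k B] : Coaction k B B where
  ρ := Coalgebra.comul
  counit_law v := by simp
  coassoc v := by simp

/-- The matrix coefficient map attached to a linear form on a comodule. -/
def coeff (c : Coaction k B V) (l : V →ₗ[k] k) : V →ₗ[k] B :=
  (TensorProduct.lid k B).toLinearMap ∘ₗ LinearMap.rTensor B l ∘ₗ c.ρ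

lemma isHom_coeff (c : Coaction k B V) (l : V →ₗ[k] k) : c.IsHom (regular k B) (c.coeff l) := by
  intro v
  have key : ∀ t : V ⊗[k] B, Coalgebra.comul (R := k)
      (TensorProduct.lid k B (LinearMap.rTensor B l t)) =
      LinearMap.rTensor B ((TensorProduct.lid k B).toLinearMap ∘ₗ LinearMap.rTensor B l)
        ((TensorProduct.assoc k V B B).symm (LinearMap.lTensor V Coalgebra.comul t)) := by
    intro t
    induction t with
    | zero => simp
    | add x y hx hy => simp only [map_add, hx, hy]
    | tmul v b =>
      simp only [LinearMap.rTensor_tmul, TensorProduct.lid_tmul, map_smul, LinearMap.lTensor_tmul]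
      generalize Coalgebra.comul (R := k) b = s
      induction s with
      | zero => simp
      | add x y hx hy => simp only [map_add, TensorProduct.tmul_add, smul_add, hx, hy]
      | tmul x y => simp [TensorProduct.smul_tmul']
  have h := key (c.ρ v)
  rw [← c.coassoc, ← LinearMap.rTensor_comp_apply] at h
  exact h

lemma counit_coeff (c : Coaction k B V) (l : V →ₗ[k] k) (v : V) :
    Coalgebra.counit (R := k) (c.coeff l v) = l v := by
  have key : ∀ t : V ⊗[k] B, Coalgebra.counit (R := k)
      (TensorProduct.lid k B (LinearMap.rTensor B l t)) = l (contract V Coalgebra.counit t) := by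
    intro t
    induction t with
    | zero => simp
    | add x y hx hy => simp only [map_add, hx, hy]
    | tmul v b => simp [mul_comm]
  conv_rhs => rw [← c.act_counit v]
  exact key (c.ρ v)

/-- The quotient of a comodule by a line of fixed vectors. -/
def quotient (c : Coaction k B V) (v : V) (hv : c.ρ v = v ⊗ₜ[k] (1 : B)) :
    Coaction k B (V ⧸ Submodule.span k {v}) where
  ρ := (Submodule.span k {v}).liftQ
    (LinearMap.rTensor B (Submodule.span k {v}).mkQ ∘ₗ c.ρ) (by
      rw [Submodule.span_singleton_le_iff_mem, LinearMap.mem_ker, LinearMap.comp_apply, hv,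
        LinearMap.rTensor_tmul, (Submodule.mkQ_apply _ _).trans
          ((Submodule.Quotient.mk_eq_zero _).2 (Submodule.mem_span_singleton_self v)),
        TensorProduct.zero_tmul])
  counit_law x := by
    obtain ⟨x, rfl⟩ := Submodule.mkQ_surjective _ x
    have h := contract_rTensor (Coalgebra.counit (R := k) (A := B))
      (Submodule.span k {v}).mkQ (c.ρ x)
    rw [← act_apply, act_counit] at h
    exact h
  coassoc x := by
    obtain ⟨x, rfl⟩ := Submodule.mkQ_surjective _ x
    set E := Submodule.span k {v}
    have h := congrArg (LinearMap.rTensor B (LinearMap.rTensor B E.mkQ)) (c.coassoc x)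
    have key : ∀ t : V ⊗[k] (B ⊗[k] B), LinearMap.rTensor B (LinearMap.rTensor B E.mkQ)
        ((TensorProduct.assoc k V B B).symm t) =
        (TensorProduct.assoc k (V ⧸ E) B B).symm (LinearMap.rTensor (B ⊗[k] B) E.mkQ t) := by
      intro t
      induction t with
      | zero => simp
      | add x y hx hy => simp only [map_add, hx, hy]
      | tmul v t =>
        induction t with
        | zero => simp
        | add x y hx hy => simp only [map_add, TensorProduct.tmul_add, hx, hy]
        | tmul x y => simp
    rw [key, ← LinearMap.comp_apply (LinearMap.rTensor (B ⊗[k] B) E.mkQ),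
      LinearMap.rTensor_comp_lTensor, ← LinearMap.lTensor_comp_rTensor,
      ← LinearMap.comp_apply (LinearMap.rTensor B (LinearMap.rTensor B E.mkQ)),
      ← LinearMap.rTensor_comp] at h
    simp only [Submodule.mkQ_apply, Submodule.liftQ_apply, LinearMap.comp_apply] at h ⊢
    rw [← h, ← LinearMap.comp_apply, ← LinearMap.rTensor_comp]
    rfl

lemma isHom_mkQ_quotient (c : Coaction k B V) (v : V) (hv : c.ρ v = v ⊗ₜ[k] (1 : B)) :
    c.IsHom (c.quotient v hv) (Submodule.span k {v}).mkQ := fun _ => rfl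

lemma IsNil.of_quotient {c : Coaction k B V} {v : V} {hv : c.ρ v = v ⊗ₜ[k] (1 : B)} {n : ℕ}
    {x : V} (h : (c.quotient v hv).IsNil n ((Submodule.span k {v}).mkQ x)) :
    c.IsNil (n + 1) x := by
  induction n generalizing x with
  | zero =>
    intro φ hφ
    obtain ⟨a, rfl⟩ := Submodule.mem_span_singleton.1 ((Submodule.Quotient.mk_eq_zero _).1 h)
    change c.act φ (a • v) = 0
    rw [map_smul, act_apply, hv, contract_tmul, hφ, zero_smul, smul_zero]
  | succ n ih =>
    intro φ hφ
    refine ih ?_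
    rw [← (c.isHom_mkQ_quotient v hv).act_map]
    exact h φ hφ

/-- A subspace stable under the action of the dual is a subcomodule. -/
lemma exists_restrict (c : Coaction k B V) (E : Submodule k V)
    (hE : ∀ x ∈ E, ∀ φ : B →ₗ[k] k, c.act φ x ∈ E) :
    ∃ d : Coaction k B E, d.IsHom c E.subtype := by
  have hinj : Function.Injective (LinearMap.rTensor B E.subtype) :=
    Module.Flat.rTensor_preserves_injective_linearMap _ E.injective_subtype
  let e := LinearEquiv.ofInjective _ hinj
  obtain ⟨ρ', hρ⟩ : ∃ ρ' : E →ₗ[k] E ⊗[k] B,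
      ∀ x : E, LinearMap.rTensor B E.subtype (ρ' x) = c.ρ x :=
    ⟨e.symm.toLinearMap ∘ₗ (c.ρ ∘ₗ E.subtype).codRestrict _
        (fun x => mem_range_rTensor_of_contract_mem E fun φ => hE x x.2 φ),
      fun x => congrArg Subtype.val (e.apply_symm_apply _)⟩
  refine ⟨⟨ρ', fun x => ?_, fun x => ?_⟩, fun x => (hρ x).symm⟩
  · refine E.injective_subtype ?_
    have h := contract_rTensor (Coalgebra.counit (R := k) (A := B)) E.subtype (ρ' x)
    rw [hρ, ← act_apply, act_counit] at h
    exact h.symm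
  · have hinj2 : Function.Injective (LinearMap.rTensor B (LinearMap.rTensor B E.subtype)) :=
      Module.Flat.rTensor_preserves_injective_linearMap _ hinj
    refine hinj2 ?_
    have key : ∀ t : E ⊗[k] (B ⊗[k] B), LinearMap.rTensor B (LinearMap.rTensor B E.subtype)
        ((TensorProduct.assoc k E B B).symm t) =
        (TensorProduct.assoc k V B B).symm (LinearMap.rTensor (B ⊗[k] B) E.subtype t) := by
      intro t
      induction t with
      | zero => simp
      | add x y hx hy => simp only [map_add, hx, hy]
      | tmul v t =>
        induction t with
        | zero => simp
        | add x y hx hy => simp only [map_add, TensorProduct.tmul_add, hx, hy]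
        | tmul x y => simp
    have hcomp : LinearMap.rTensor B E.subtype ∘ₗ ρ' = c.ρ ∘ₗ E.subtype := LinearMap.ext hρ
    rw [key, ← LinearMap.comp_apply (LinearMap.rTensor (B ⊗[k] B) E.subtype),
      LinearMap.rTensor_comp_lTensor, ← LinearMap.lTensor_comp_rTensor,
      ← LinearMap.comp_apply (LinearMap.rTensor B (LinearMap.rTensor B E.subtype)),
      ← LinearMap.rTensor_comp, hcomp, LinearMap.rTensor_comp, LinearMap.comp_apply,
      LinearMap.comp_apply, hρ, c.coassoc]

/-- Local finiteness of comodules. -/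
lemma exists_finite_stable (c : Coaction k B V) (v : V) :
    ∃ E : Submodule k V, Module.Finite k E ∧ v ∈ E ∧
      ∀ x ∈ E, ∀ φ : B →ₗ[k] k, c.act φ x ∈ E := by
  obtain ⟨F, hF, h⟩ := exists_fg_forall_contract_mem (c.ρ v)
  have := Module.Finite.iff_fg.2 hF
  refine ⟨Submodule.span k (Set.range fun φ : B →ₗ[k] k => c.act φ v), ?_, ?_, ?_⟩
  · exact Submodule.finiteDimensional_of_le (S₂ := F)
      (Submodule.span_le.2 (Set.range_subset_iff.2 h))
  · exact Submodule.subset_span ⟨Coalgebra.counit, c.act_counit v⟩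
  · intro x hx ψ
    induction hx using Submodule.span_induction with
    | mem x hx =>
      obtain ⟨φ, rfl⟩ := hx
      exact Submodule.subset_span ⟨_, (c.act_act φ ψ v).symm⟩
    | zero => simp
    | add x y _ _ hx hy => rw [map_add]; exact add_mem hx hy
    | smul a x _ hx => rw [map_smul]; exact Submodule.smul_mem _ _ hx

end Constructions

end Coaction

section Unipotent

variable {k B C : Type} [Field k] [CommRing B] [HopfAlgebra k B] [CommRing C] [HopfAlgebra k C]

lemma IsUnipotentHopf.isNil_of_finrank_le (hB : IsUnipotentHopf k B) (n : ℕ) (V : Type)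
    [AddCommGroup V] [Module k V] [Module.Finite k V] (hn : Module.finrank k V ≤ n)
    (c : Coaction k B V) (v : V) : c.IsNil n v := by
  induction n generalizing V with
  | zero =>
    have := Module.finrank_zero_iff.1 (Nat.le_zero.1 hn)
    exact Subsingleton.elim v 0
  | succ n ih =>
    cases subsingleton_or_nontrivial V with
    | inl _ => exact Subsingleton.elim v 0 ▸ c.isNil_zero _
    | inr hV =>
      obtain ⟨w, hw, hfix⟩ := hB V c hV
      refine (ih _ ?_ (c.quotient w hfix) _).of_quotient
      have h1 := Submodule.finrank_quotient_add_finrank (Submodule.span k {w})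
      rw [finrank_span_singleton hw] at h1
      omega

lemma IsUnipotentHopf.exists_isNil_regular (hB : IsUnipotentHopf k B) (b : B) :
    ∃ n, (Coaction.regular k B).IsNil n b := by
  obtain ⟨E, hfin, hb, hE⟩ := (Coaction.regular k B).exists_finite_stable b
  obtain ⟨d, hd⟩ := (Coaction.regular k B).exists_restrict E hE
  exact ⟨_, (hB.isNil_of_finrank_le _ E le_rfl d ⟨b, hb⟩).map hd⟩

lemma Coaction.IsNil.map_bialgHom (q : B →ₐc[k] C) {n : ℕ} {b : B}
    (h : (Coaction.regular k B).IsNil n b) : (Coaction.regular k C).IsNil n (q b) := by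
  induction n generalizing b with
  | zero =>
    obtain rfl : b = 0 := h
    exact map_zero q
  | succ n ih =>
    intro φ hφ
    have key : ∀ t : B ⊗[k] B, contract C φ (TensorProduct.map (q : B →ₗ[k] C) (q : B →ₗ[k] C) t)
        = q (contract B (φ ∘ₗ (q : B →ₗ[k] C)) t) := by
      intro t
      induction t with
      | zero => simp
      | add x y hx hy => simp only [map_add, hx, hy]
      | tmul x y => simp
    have hact : (Coaction.regular k C).act φ (q b) =
        q ((Coaction.regular k B).act (φ ∘ₗ (q : B →ₗ[k] C)) b) := by
      refine Eq.trans ?_ (key _)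
      exact congrArg (contract C φ) (CoalgHomClass.map_comp_comul_apply q b).symm
    rw [hact]
    exact ih (h _ (by simpa using hφ))

/-- A closed subgroup scheme of a unipotent group scheme is unipotent. -/
theorem IsUnipotentHopf.of_surjective (hB : IsUnipotentHopf k B) (q : B →ₐc[k] C)
    (hq : Function.Surjective q) : IsUnipotentHopf k C := by
  intro V _ _ _ c _
  obtain ⟨v, hv⟩ := exists_ne (0 : V)
  let b := Module.finBasis k V
  have hex : ∀ i, ∃ n, (Coaction.regular k C).IsNil n (c.coeff (b.coord i) v) := fun i => by
    obtain ⟨x, hx⟩ := hq (c.coeff (b.coord i) v)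
    obtain ⟨n, hn⟩ := hB.exists_isNil_regular x
    exact ⟨n, hx ▸ hn.map_bialgHom q⟩
  choose n hn using hex
  have hnil : c.IsNil (Finset.univ.sup n) v := by
    refine Coaction.isNil_of_forall_map (fun i => c.isHom_coeff (b.coord i)) (fun w hw => ?_)
      fun i => (hn i).mono (Finset.le_sup (Finset.mem_univ i))
    refine b.ext_elem fun i => ?_
    have h := c.counit_coeff (b.coord i) w
    rw [hw i, map_zero] at h
    simpa using h.symm
  exact hnil.exists_fixed hv

end Unipotent

section Points

variable {k A R S : Type} [Field k] [CommRing A] [HopfAlgebra k A] [CommRing R] [Algebra k R]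
  [CommRing S] [Algebra k S]

lemma comp_ptMul (σ : R →ₐ[k] S) (f g : A →ₐ[k] R) :
    σ.comp (ptMul f g) = ptMul (σ.comp f) (σ.comp g) := by
  rw [ptMul, ptMul, ← AlgHom.comp_assoc]
  congr 1
  ext <;> simp

lemma ptMul_eq_convMul (f g : A →ₐ[k] R) :
    ptMul f g = (WithConv.toConv f * WithConv.toConv g).ofConv := by
  rw [AlgHom.convMul_def, ptMul, ← AlgHom.comp_assoc]
  congr 1
  ext <;> simp

lemma ptOne_eq_convOne : (ptOne R : A →ₐ[k] R) = (1 : WithConv (A →ₐ[k] R)).ofConv := rfl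

lemma ptMul_one (f : A →ₐ[k] R) : ptMul f (ptOne R) = f := by
  rw [ptMul_eq_convMul, ptOne_eq_convOne, WithConv.toConv_ofConv, mul_one]

lemma ptMul_comp_antipode (g : A →ₐ[k] R) :
    ptMul g (g.comp (HopfAlgebra.antipodeAlgHom k A)) = ptOne R := by
  have h : ptMul (AlgHom.id k A) (HopfAlgebra.antipodeAlgHom k A) = ptOne A := by
    rw [ptMul_eq_convMul]
    exact congrArg WithConv.ofConv (mul_inv_cancel (WithConv.toConv (AlgHom.id k A)))
  refine (comp_ptMul g (AlgHom.id k A) _).symm.trans ?_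
  rw [h]
  ext a
  simp [ptOne]

lemma ptMul_assoc (f g h : A →ₐ[k] R) : ptMul (ptMul f g) h = ptMul f (ptMul g h) := by
  simp only [ptMul_eq_convMul, WithConv.toConv_ofConv, mul_assoc]

lemma eq_ptOne_of_ptMul_eq_right {f g : A →ₐ[k] R} (h : ptMul f g = g) : f = ptOne R := by
  rw [← ptMul_one f, ← ptMul_comp_antipode g, ← ptMul_assoc, h]

end Points

section FrobeniusKernel

variable {k : Type} [Field k] (p : ℕ) {A R : Type} [CommRing A] [HopfAlgebra k A] [CommRing R]
  [Algebra k R]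

variable (k A) in
/-- The ideal defining the Frobenius kernel. -/
def frobKerIdeal : Ideal A :=
  Ideal.span {x | ∃ a : A, Coalgebra.counit (R := k) a = 0 ∧ a ^ p = x}

lemma frobKerIdeal_le_ker_iff (f : A →ₐ[k] R) :
    frobKerIdeal k p A ≤ RingHom.ker f ↔ InFrobKer p f := by
  rw [frobKerIdeal, Ideal.span_le]
  constructor
  · intro h a ha
    rw [← map_pow]
    exact h ⟨a, ha, rfl⟩
  · rintro h _ ⟨a, ha, rfl⟩
    exact (map_pow f a p).trans (h a ha)

variable [Fact p.Prime] [CharP k p]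

/-- The ring `R`, regarded as a `k`-algebra through the Frobenius of `k`. -/
def FrobTwist (_k R : Type) (_p : ℕ) : Type := R

instance (R : Type) [CommRing R] : CommRing (FrobTwist k R p) := inferInstanceAs (CommRing R)

instance (R : Type) [CommRing R] [Algebra k R] : Algebra k (FrobTwist k R p) :=
  ((algebraMap k R).comp (frobenius k p)).toAlgebra

/-- Frobenius as a `k`-algebra morphism to the twist. -/
def frobTwistHom (R : Type) [CommRing R] [Algebra k R] [ExpChar R p] :
    R →ₐ[k] FrobTwist k R p where
  __ := frobenius R p
  commutes' c := (map_pow (algebraMap k R) c p).symm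

lemma inFrobKer_iff_comp_eq_ptOne [ExpChar R p] (f : A →ₐ[k] R) :
    InFrobKer p f ↔ (frobTwistHom p R).comp f = ptOne (FrobTwist k R p) := by
  constructor
  · intro h
    ext a
    have h1 := h (a - algebraMap k A (Coalgebra.counit a)) (by simp)
    rw [map_sub, sub_pow_expChar, sub_eq_zero, AlgHom.commutes] at h1
    exact h1.trans (map_pow (algebraMap k R) _ p).symm
  · intro h a ha
    have h1 := DFunLike.congr_fun h a
    refine h1.trans ?_
    change algebraMap k (FrobTwist k R p) (Coalgebra.counit a) = 0
    rw [ha, map_zero]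

lemma subsingleton_or_expChar (k R : Type) [Field k] (p : ℕ) [Fact p.Prime] [CharP k p]
    [CommRing R] [Algebra k R] : Subsingleton R ∨ ExpChar R p := by
  cases subsingleton_or_nontrivial R with
  | inl h => exact Or.inl h
  | inr h =>
    have := charP_of_injective_algebraMap (algebraMap k R).injective p
    exact Or.inr inferInstance

lemma InFrobKer.ptMul {f g : A →ₐ[k] R} (hf : InFrobKer p f) (hg : InFrobKer p g) :
    InFrobKer p (ptMul f g) := by
  obtain h | h := subsingleton_or_expChar k R p
  · exact fun _ _ => Subsingleton.elim _ _
  · rw [inFrobKer_iff_comp_eq_ptOne] at hf hg ⊢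
    rw [comp_ptMul, hf, hg, ptMul_one]

/-- The Frobenius kernel is normal. -/
lemma InFrobKer.of_ptMul_eq {f f' g : A →ₐ[k] R} (hf : InFrobKer p f)
    (h : _root_.ptMul g f = _root_.ptMul f' g) : InFrobKer p f' := by
  obtain h' | h' := subsingleton_or_expChar k R p
  · exact fun _ _ => Subsingleton.elim _ _
  · rw [inFrobKer_iff_comp_eq_ptOne] at hf ⊢
    refine eq_ptOne_of_ptMul_eq_right (g := (frobTwistHom p R).comp g) ?_
    rw [← comp_ptMul, ← h, comp_ptMul, hf, ptMul_one]

instance isHopfIdeal_frobKerIdeal : (frobKerIdeal k p A).IsHopfIdeal k where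
  counit_eq_zero := by
    have h := (frobKerIdeal_le_ker_iff p (Bialgebra.counitAlgHom k A)).2 fun a ha => by
      rw [Bialgebra.counitAlgHom_apply, ha, zero_pow (Fact.out : p.Prime).ne_zero]
    exact fun x hx => h hx
  map_mkQ_comul_eq_zero := by
    let q := Ideal.Quotient.mkₐ k (frobKerIdeal k p A)
    have hq : ∀ {T : Type} [CommRing T] [Algebra k T] (j : (A ⧸ frobKerIdeal k p A) →ₐ[k] T),
        InFrobKer p (j.comp q) := fun j =>
      (frobKerIdeal_le_ker_iff p _).1 fun x hx => by
        have hx0 : q x = 0 := Ideal.Quotient.eq_zero_iff_mem.2 hx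
        rw [RingHom.mem_ker, AlgHom.comp_apply, hx0, map_zero]
    let Q := A ⧸ frobKerIdeal k p A
    let j₁ : Q →ₐ[k] Q ⊗[k] Q := Algebra.TensorProduct.includeLeft
    let j₂ : Q →ₐ[k] Q ⊗[k] Q := Algebra.TensorProduct.includeRight
    have h := (frobKerIdeal_le_ker_iff p _).2 (InFrobKer.ptMul p (hq j₁) (hq j₂))
    have hmap : Algebra.TensorProduct.productMap (j₁.comp q) (j₂.comp q) =
        Algebra.TensorProduct.map q q := by
      ext <;> simp [j₁, j₂]
    rw [ptMul, hmap] at h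
    exact fun x hx => h hx
  antipode_mem := by
    have h : frobKerIdeal k p A ≤
        (frobKerIdeal k p A).comap (HopfAlgebra.antipodeAlgHom k A) := by
      conv_lhs => rw [frobKerIdeal]
      rw [Ideal.span_le]
      rintro _ ⟨a, ha, rfl⟩
      refine Ideal.subset_span ⟨HopfAlgebra.antipode k a, ?_,
        (map_pow (HopfAlgebra.antipodeAlgHom k A) a p).symm⟩
      rw [HopfAlgebra.counit_antipode, ha]
    exact fun x hx => h hx

/-- The Frobenius kernel of a closed subgroup scheme. -/
def ClosedSubgrp.frobKer (H : ClosedSubgrp k A) : ClosedSubgrp k A where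
  B := H.B ⧸ frobKerIdeal k p H.B
  π := (Bialgebra.Quotient.mkBialgHom (frobKerIdeal k p H.B)).comp H.π
  surj := Ideal.Quotient.mk_surjective.comp H.surj

lemma ClosedSubgrp.frobKer_mem_iff (H : ClosedSubgrp k A) (f : A →ₐ[k] R) :
    (H.frobKer p).mem f ↔ H.mem f ∧ InFrobKer p f := by
  constructor
  · rintro ⟨g, rfl⟩
    refine ⟨⟨g.comp (Ideal.Quotient.mkₐ k _), rfl⟩, fun a ha => ?_⟩
    have h : Ideal.Quotient.mk (frobKerIdeal k p H.B) (H.π a ^ p) = 0 :=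
      Ideal.Quotient.eq_zero_iff_mem.2 (Ideal.subset_span
        ⟨H.π a, (CoalgHomClass.counit_comp_apply H.π a).trans ha, rfl⟩)
    rw [map_pow] at h
    exact (map_pow g _ p).symm.trans ((congrArg g h).trans (map_zero g))
  · rintro ⟨⟨g, rfl⟩, hf⟩
    have hg : InFrobKer p g := by
      intro b hb
      obtain ⟨a, rfl⟩ := H.surj b
      exact hf a ((CoalgHomClass.counit_comp_apply H.π a).symm.trans hb)
    exact ⟨Ideal.Quotient.liftₐ _ g ((frobKerIdeal_le_ker_iff p g).2 hg), rfl⟩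

end FrobeniusKernel

lemma eq_bot_of_le_sq_of_connectedSpace {B : Type} [CommRing B] [IsNoetherianRing B]
    (hB : ConnectedSpace (PrimeSpectrum B)) {I : Ideal B} (hI : I ≠ ⊤) (h : I ≤ I ^ 2) :
    I = ⊥ := by
  have hidem : IsIdempotentElem I := le_antisymm Ideal.mul_le_left (by rwa [← pow_two])
  obtain ⟨e, he, rfl⟩ := (Ideal.isIdempotentElem_iff_of_fg I (IsNoetherian.noetherian I)).1 hidem
  rcases isClopen_iff.1 (PrimeSpectrum.isIdempotentElemEquivClopens ⟨e, he⟩).isClopen with h0 | h1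
  · obtain ⟨n, hn⟩ := (PrimeSpectrum.basicOpen_eq_bot_iff e).1 (TopologicalSpace.Opens.ext h0)
    have he0 : e = 0 := by rw [← he.pow_succ_eq n, pow_succ, hn, zero_mul]
    rw [he0, Ideal.submodule_span_eq, Ideal.span_singleton_eq_bot]
  · obtain ⟨m, hm, hle⟩ := Ideal.exists_le_maximal _ hI
    have hmem : (⟨m, hm.isPrime⟩ : PrimeSpectrum B) ∈ (PrimeSpectrum.isIdempotentElemEquivClopens
        ⟨e, he⟩ : Set (PrimeSpectrum B)) := h1 ▸ Set.mem_univ _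
    exact absurd (hle (Submodule.mem_span_singleton_self e)) hmem

/-- A connected group scheme of finite type with trivial Frobenius kernel is trivial. -/
lemma ker_counit_eq_bot_of_le_frobKerIdeal {k B : Type} [Field k] (p : ℕ) [Fact p.Prime]
    [CommRing B] [HopfAlgebra k B] [IsNoetherianRing B]
    (hB : ConnectedSpace (PrimeSpectrum B))
    (h : RingHom.ker (Bialgebra.counitAlgHom k B) ≤ frobKerIdeal k p B) :
    RingHom.ker (Bialgebra.counitAlgHom k B) = ⊥ := by
  refine eq_bot_of_le_sq_of_connectedSpace hB (RingHom.ker_ne_top _) (h.trans ?_)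
  rw [frobKerIdeal, Ideal.span_le]
  rintro _ ⟨a, ha, rfl⟩
  exact Ideal.pow_le_pow_right (Fact.out : p.Prime).two_le (Ideal.pow_mem_pow ha p)

/-- **Corollary.** Let `k` have characteristic `p > 0` and let `G = Spec A` be a
smooth connected affine algebraic group over `k`.  If the Frobenius kernel `G₁` of `G`
has trivial restricted unipotent radical — i.e. every unipotent closed subgroup scheme
of `G` contained in `G₁` and normal in `G₁` is trivial — then `G` is pseudo-reductive:
every smooth connected unipotent normal closed subgroup scheme of `G` is trivial. -/
theorem pseudoReductive_of_frobKernel_pReductive (k A : Type) [Field k] (p : ℕ)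
    [Fact p.Prime] [CharP k p] [CommRing A] [HopfAlgebra k A] [Algebra.Smooth k A]
    (hconn : ConnectedSpace (PrimeSpectrum A))
    (hG1 : ∀ H : ClosedSubgrp k A,
      (∀ (R : Type) (_ : CommRing R) (_ : Algebra k R), ∀ f : A →ₐ[k] R,
        H.mem f → InFrobKer p f) →
      (∀ (R : Type) (_ : CommRing R) (_ : Algebra k R), ∀ f g : A →ₐ[k] R,
        InFrobKer p g → H.mem f →
          ∃ f' : A →ₐ[k] R, H.mem f' ∧ ptMul g f = ptMul f' g) →
      IsUnipotentHopf k H.B → H.Trivial) :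
    ∀ H : ClosedSubgrp k A, H.Normal → IsUnipotentHopf k H.B →
      Algebra.Smooth k H.B → ConnectedSpace (PrimeSpectrum H.B) → H.Trivial := by
  intro H hnormal hunip hsmooth hHconn
  have hmem : ∀ {R : Type} [CommRing R] [Algebra k R] (f : A →ₐ[k] R),
      (H.frobKer p).mem f ↔ H.mem f ∧ InFrobKer p f := H.frobKer_mem_iff p
  have htriv : (H.frobKer p).Trivial := by
    refine hG1 _ (fun R _ _ f hf => ((hmem f).1 hf).2) (fun R _ _ f g _ hf => ?_)
      (hunip.of_surjective (Bialgebra.Quotient.mkBialgHom (frobKerIdeal k p H.B))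
        Ideal.Quotient.mk_surjective)
    obtain ⟨hfH, hfp⟩ := (hmem f).1 hf
    obtain ⟨f', hf', heq⟩ := hnormal R f g hfH
    exact ⟨f', (hmem f').2 ⟨hf', hfp.of_ptMul_eq p heq⟩, heq⟩
  have hle : RingHom.ker (Bialgebra.counitAlgHom k H.B) ≤ frobKerIdeal k p H.B := by
    intro b hb
    obtain ⟨a, rfl⟩ := H.surj b
    have h := DFunLike.congr_fun (htriv _ _ ⟨AlgHom.id k (H.frobKer p).B, rfl⟩) a
    refine Ideal.Quotient.eq_zero_iff_mem.1 (h.trans ?_)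
    change algebraMap k (H.frobKer p).B (Coalgebra.counit a) = 0
    rw [← CoalgHomClass.counit_comp_apply H.π a]
    exact (congrArg _ hb).trans (map_zero _)
  have : IsNoetherianRing H.B := Algebra.FiniteType.isNoetherianRing k H.B
  have hbot := ker_counit_eq_bot_of_le_frobKerIdeal p hHconn hle
  rintro R _ _ _ ⟨g, rfl⟩
  ext a
  have h0 : H.π a - algebraMap k H.B (Coalgebra.counit a) = 0 := by
    rw [← Ideal.mem_bot, ← hbot, RingHom.mem_ker]
    simp
  have h1 := congrArg g h0
  rw [map_sub, AlgHom.commutes, map_zero, sub_eq_zero] at h1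
  exact h1

end
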